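/- arXiv:1111.6927 — 3 statements merged into one kernel-verified Lean document; each statement's English description precedes it below -/
import Mathlib

section
/- Every element α of Λ has a unique representation in form (L): α = b^{i_0} a b^{i_1} a ⋯ b^{i_{k−1}} a b^p with all i_μ ∈ [0, d) and p ∈ ℤ, and a unique representation in form (R): α = b^q a b^{j_1} a b^{j_2} ⋯ a b^{j_k} with all j_μ ∈ [0, c) and q ∈ ℤ, where in both representations k = θ(α). Moreover, in cases (BS1) and (BS2) one has p ≥ 0 and q ≥ 0, and in case (BS3), if θ(α) = 0, then p = q ≥ 0. -/
inductive BSGen : Type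
  | a : BSGen
  | b : BSGen

/-- The relations for the Baumslag–Solitar presentation `⟨a, b | a bᶜ = bᵉ a⟩`.
For cases (BS1), (BS2) take `e = d`; for case (BS3) take `e = -d`. -/
def BSRel (c e : ℤ) : Set (FreeGroup BSGen) :=
  {FreeGroup.of BSGen.a * FreeGroup.of BSGen.b ^ c *
    (FreeGroup.of BSGen.b ^ e * FreeGroup.of BSGen.a)⁻¹}

/-- The Baumslag–Solitar group `Γ = ⟨a, b | a bᶜ = bᵉ a⟩`. -/
abbrev BSGroup (c e : ℤ) := PresentedGroup (BSRel c e)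

/-- The generator `a` of `Γ`. -/
def bsa (c e : ℤ) : BSGroup c e := PresentedGroup.of BSGen.a

/-- The generator `b` of `Γ`. -/
def bsb (c e : ℤ) : BSGroup c e := PresentedGroup.of BSGen.b

/-- `Λ`, the submonoid of `Γ` generated by `a` and `b`. -/
def bsΛ (c e : ℤ) : Submonoid (BSGroup c e) :=
  Submonoid.closure {bsa c e, bsb c e}

namespace HNNExtension

variable {G : Type*} [Group G] {A B : Subgroup G} {φ : A ≃* B}

/-- Elements of an HNN extension that can be written with all stable letters of sign `u`. -/
def IsUnidirectional (u : ℤˣ) (x : HNNExtension G A B φ) : Prop :=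
  ∃ (g : G) (l : List G), x = of g * (l.map fun h => t ^ (u : ℤ) * of h).prod

theorem isUnidirectional_of (u : ℤˣ) (g : G) :
    IsUnidirectional u (of g : HNNExtension G A B φ) :=
  ⟨g, [], by simp⟩

theorem IsUnidirectional.of_mul_t_zpow_mul {u : ℤˣ} {x : HNNExtension G A B φ}
    (hx : IsUnidirectional u x) (g : G) : IsUnidirectional u (of g * t ^ (u : ℤ) * x) := by
  obtain ⟨h, l, rfl⟩ := hx
  exact ⟨g, h :: l, by simp [mul_assoc]⟩

theorem IsUnidirectional.inv_mul_mem_toSubgroup {u : ℤˣ} {x y : HNNExtension G A B φ}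
    (hx : IsUnidirectional u x) (hy : IsUnidirectional u y) {g h : G}
    (hxy : of g * t ^ (u : ℤ) * x = of h * t ^ (u : ℤ) * y) :
    g⁻¹ * h ∈ toSubgroup A B (-u) := by
  obtain ⟨g₁, l₁, rfl⟩ := hx
  obtain ⟨g₂, l₂, rfl⟩ := hy
  let word (k : G) (l : List G) : NormalWord.ReducedWord G A B :=
    { head := k
      toList := l.map fun m => (u, m)
      chain := by
        rw [List.isChain_map]
        exact (List.pairwise_of_forall fun _ _ _ => rfl).isChain }
  have hprod : (word g (g₁ :: l₁)).prod φ = (word h (g₂ :: l₂)).prod φ := by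
    simpa [word, NormalWord.ReducedWord.prod, Function.comp_def, mul_assoc] using hxy
  exact (ReducedWord.map_fst_eq_and_of_prod_eq φ hprod).2 u (by simp [word])

end HNNExtension

namespace BSGroup

open HNNExtension

theorem zpowGroupHom_injective {n : ℤ} (hn : n ≠ 0) :
    Function.Injective (zpowGroupHom n : Multiplicative ℤ →* Multiplicative ℤ) := by
  intro x y hxy
  have h : n * x.toAdd = n * y.toAdd := by
    simpa using congrArg Multiplicative.toAdd hxy
  exact Multiplicative.toAdd.injective (mul_left_cancel₀ hn h)

/-- The isomorphism `cℤ ≃ eℤ` sending `c` to `e`, written multiplicatively. -/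
noncomputable def rangeEquiv {c e : ℤ} (hc : c ≠ 0) (he : e ≠ 0) :
    (zpowGroupHom c : Multiplicative ℤ →* Multiplicative ℤ).range ≃*
      (zpowGroupHom e : Multiplicative ℤ →* Multiplicative ℤ).range :=
  (MonoidHom.ofInjective (zpowGroupHom_injective hc)).symm.trans
    (MonoidHom.ofInjective (zpowGroupHom_injective he))

theorem rangeEquiv_ofInjective {c e : ℤ} (hc : c ≠ 0) (he : e ≠ 0) (x : Multiplicative ℤ) :
    rangeEquiv hc he (MonoidHom.ofInjective (zpowGroupHom_injective hc) x) =
      MonoidHom.ofInjective (zpowGroupHom_injective he) x := by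
  simp [rangeEquiv]

/-- The HNN extension of `ℤ` identifying `cℤ` with `eℤ`. -/
abbrev HNN {c e : ℤ} (hc : c ≠ 0) (he : e ≠ 0) :=
  HNNExtension (Multiplicative ℤ) _ _ (rangeEquiv hc he)

theorem t_mul_of_zpow {c e : ℤ} (hc : c ≠ 0) (he : e ≠ 0) :
    (t : HNN hc he) * of (Multiplicative.ofAdd 1) ^ c = of (Multiplicative.ofAdd 1) ^ e * t := by
  have h := t_mul_of (φ := rangeEquiv hc he)
    (MonoidHom.ofInjective (zpowGroupHom_injective hc) (Multiplicative.ofAdd 1))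
  simpa only [rangeEquiv_ofInjective, MonoidHom.ofInjective_apply, zpowGroupHom_apply, map_zpow]
    using h

/-- The images of the generators in the HNN extension. -/
noncomputable def generatorImage {c e : ℤ} (hc : c ≠ 0) (he : e ≠ 0) : BSGen → HNN hc he
  | .a => t
  | .b => of (Multiplicative.ofAdd 1)

/-- The canonical homomorphism from the Baumslag–Solitar group to the HNN extension. -/
noncomputable def toHNN {c e : ℤ} (hc : c ≠ 0) (he : e ≠ 0) : BSGroup c e →* HNN hc he :=
  PresentedGroup.toGroup (f := generatorImage hc he) (by
    rintro r rfl
    rw [map_mul, map_inv, mul_inv_eq_one]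
    simpa [generatorImage] using t_mul_of_zpow hc he)

section toHNN

variable {c e : ℤ} (hc : c ≠ 0) (he : e ≠ 0)

@[simp]
theorem toHNN_bsa : toHNN hc he (bsa c e) = t :=
  PresentedGroup.toGroup.of _

@[simp]
theorem toHNN_bsb_zpow (n : ℤ) :
    toHNN hc he (bsb c e ^ n) = of (Multiplicative.ofAdd n) := by
  have h : toHNN hc he (bsb c e) = of (Multiplicative.ofAdd 1) := PresentedGroup.toGroup.of _
  rw [map_zpow, h, ← map_zpow, ← ofAdd_zsmul, smul_eq_mul, mul_one]

theorem bsb_zpow_injective (hc : c ≠ 0) (he : e ≠ 0) :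
    Function.Injective fun n : ℤ => bsb c e ^ n := by
  intro m n hmn
  have h := congrArg (toHNN hc he) hmn
  simp only [toHNN_bsb_zpow] at h
  exact Multiplicative.ofAdd.injective (of_injective _ h)

end toHNN

variable {c e : ℤ}

theorem bsa_mul_bsb_zpow_mul (c e n : ℤ) :
    bsa c e * bsb c e ^ (c * n) = bsb c e ^ (e * n) * bsa c e := by
  have h : SemiconjBy (bsa c e) (bsb c e ^ c) (bsb c e ^ e) := by
    have hr := PresentedGroup.one_of_mem (rels := BSRel c e) (Set.mem_singleton _)
    rwa [map_mul, map_inv, mul_inv_eq_one, map_mul, map_mul, map_zpow, map_zpow] at hr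
  simpa only [zpow_mul] using (h.zpow_right n).eq

/-- The element `b^{i₀} a b^{i₁} a ⋯ b^{i_{k-1}} a b^p`. -/
def leftForm (c e : ℤ) (l : List ℤ) (p : ℤ) : BSGroup c e :=
  (l.map fun m => bsb c e ^ m * bsa c e).prod * bsb c e ^ p

/-- The element `b^q a b^{j₁} a ⋯ a b^{j_k}`. -/
def rightForm (c e : ℤ) (q : ℤ) (l : List ℤ) : BSGroup c e :=
  bsb c e ^ q * (l.map fun m => bsa c e * bsb c e ^ m).prod

@[simp]
theorem leftForm_nil (p : ℤ) : leftForm c e [] p = bsb c e ^ p := by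
  simp [leftForm]

theorem leftForm_cons (m : ℤ) (l : List ℤ) (p : ℤ) :
    leftForm c e (m :: l) p = bsb c e ^ m * bsa c e * leftForm c e l p := by
  simp [leftForm, mul_assoc]

theorem leftForm_append_singleton (l : List ℤ) (m p : ℤ) :
    leftForm c e (l ++ [m]) p = leftForm c e l m * bsa c e * bsb c e ^ p := by
  simp [leftForm, mul_assoc]

@[simp]
theorem rightForm_nil (q : ℤ) : rightForm c e q [] = bsb c e ^ q := by
  simp [rightForm]

theorem rightForm_cons (q m : ℤ) (l : List ℤ) :
    rightForm c e q (m :: l) = bsb c e ^ q * bsa c e * rightForm c e m l := by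
  simp [rightForm, mul_assoc]

theorem rightForm_append_singleton (q : ℤ) (l : List ℤ) (m : ℤ) :
    rightForm c e q (l ++ [m]) = rightForm c e q l * (bsa c e * bsb c e ^ m) := by
  simp [rightForm, mul_assoc]

theorem isUnidirectional_toHNN_leftForm (hc : c ≠ 0) (he : e ≠ 0) (l : List ℤ) (p : ℤ) :
    IsUnidirectional 1 (toHNN hc he (leftForm c e l p)) := by
  induction l with
  | nil => simpa using isUnidirectional_of 1 _
  | cons m l ih => simpa [leftForm_cons] using ih.of_mul_t_zpow_mul (Multiplicative.ofAdd m)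

theorem isUnidirectional_toHNN_rightForm_inv (hc : c ≠ 0) (he : e ≠ 0) (q : ℤ) (l : List ℤ) :
    IsUnidirectional (-1) (toHNN hc he (rightForm c e q l))⁻¹ := by
  induction l using List.reverseRecOn with
  | nil => simpa [← map_inv] using isUnidirectional_of (-1) _
  | append_singleton l m ih =>
    simpa [rightForm_append_singleton, ← map_inv] using
      ih.of_mul_t_zpow_mul (Multiplicative.ofAdd m)⁻¹

theorem dvd_of_mem_range_zpowGroupHom {n m : ℤ}
    (h : Multiplicative.ofAdd m ∈ (zpowGroupHom n : Multiplicative ℤ →* Multiplicative ℤ).range) :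
    n ∣ m := by
  obtain ⟨k, hk⟩ := h
  exact ⟨k.toAdd, by simpa using (congrArg Multiplicative.toAdd hk).symm⟩

theorem dvd_of_leftForm_cons_eq (hc : c ≠ 0) (he : e ≠ 0) {i j : ℤ} {l l' : List ℤ} {p p' : ℤ}
    (h : leftForm c e (i :: l) p = leftForm c e (j :: l') p') : e ∣ j - i := by
  have h' := congrArg (toHNN hc he) h
  simp only [leftForm_cons, map_mul, toHNN_bsa, toHNN_bsb_zpow] at h'
  have hmem := (isUnidirectional_toHNN_leftForm hc he l p).inv_mul_mem_toSubgroup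
    (isUnidirectional_toHNN_leftForm hc he l' p') (by simpa using h')
  rw [toSubgroup_neg_one, ← ofAdd_neg, ← ofAdd_add, neg_add_eq_sub] at hmem
  exact dvd_of_mem_range_zpowGroupHom hmem

theorem dvd_of_rightForm_append_eq (hc : c ≠ 0) (he : e ≠ 0) {i j : ℤ} {l l' : List ℤ}
    {q q' : ℤ} (h : rightForm c e q (l ++ [i]) = rightForm c e q' (l' ++ [j])) : c ∣ i - j := by
  have h' := congrArg (fun x => (toHNN hc he x)⁻¹) h
  simp only [rightForm_append_singleton, map_mul, toHNN_bsa, toHNN_bsb_zpow, mul_inv_rev,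
    ← map_inv (of : _ →* HNN hc he)] at h'
  have hmem := (isUnidirectional_toHNN_rightForm_inv hc he q l).inv_mul_mem_toSubgroup
    (isUnidirectional_toHNN_rightForm_inv hc he q' l') h'
  rw [neg_neg, toSubgroup_one, inv_inv, ← ofAdd_neg, ← ofAdd_add, ← sub_eq_add_neg] at hmem
  exact dvd_of_mem_range_zpowGroupHom hmem

theorem eq_of_dvd_sub_of_mem_Ico {d i j : ℤ} (h : d ∣ i - j) (hi : 0 ≤ i ∧ i < d)
    (hj : 0 ≤ j ∧ j < d) : i = j :=
  sub_eq_zero.mp (Int.eq_zero_of_abs_lt_dvd h (abs_sub_lt_of_nonneg_of_lt hi.1 hi.2 hj.1 hj.2))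

theorem leftForm_unique (hc : c ≠ 0) (he : e ≠ 0) {d : ℤ} (hde : d ∣ e) {l l' : List ℤ}
    {p p' : ℤ} (hlen : l.length = l'.length) (hl : ∀ m ∈ l, 0 ≤ m ∧ m < d)
    (hl' : ∀ m ∈ l', 0 ≤ m ∧ m < d) (h : leftForm c e l p = leftForm c e l' p') :
    l = l' ∧ p = p' := by
  induction l generalizing l' with
  | nil =>
    obtain rfl := List.length_eq_zero_iff.mp hlen.symm
    exact ⟨rfl, bsb_zpow_injective hc he (by simpa using h)⟩
  | cons i l ih =>
    obtain _ | ⟨j, l'⟩ := l'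
    · simp at hlen
    rw [List.forall_mem_cons] at hl hl'
    obtain rfl := eq_of_dvd_sub_of_mem_Ico (hde.trans (dvd_of_leftForm_cons_eq hc he h)) hl'.1 hl.1
    rw [leftForm_cons, leftForm_cons, mul_right_inj] at h
    obtain ⟨rfl, rfl⟩ := ih (by simpa using hlen) hl.2 hl'.2 h
    exact ⟨rfl, rfl⟩

theorem rightForm_unique (hc : c ≠ 0) (he : e ≠ 0) {l l' : List ℤ}
    {q q' : ℤ} (hlen : l.length = l'.length) (hl : ∀ m ∈ l, 0 ≤ m ∧ m < c)
    (hl' : ∀ m ∈ l', 0 ≤ m ∧ m < c) (h : rightForm c e q l = rightForm c e q' l') :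
    q = q' ∧ l = l' := by
  induction l using List.reverseRecOn generalizing l' with
  | nil =>
    obtain rfl := List.length_eq_zero_iff.mp hlen.symm
    exact ⟨bsb_zpow_injective hc he (by simpa using h), rfl⟩
  | append_singleton l i ih =>
    obtain rfl | ⟨l', j, rfl⟩ := l'.eq_nil_or_concat'
    · simp at hlen
    rw [List.forall_mem_append, List.forall_mem_singleton] at hl hl'
    obtain rfl := eq_of_dvd_sub_of_mem_Ico (dvd_of_rightForm_append_eq hc he h) hl.2 hl'.2
    rw [rightForm_append_singleton, rightForm_append_singleton, mul_left_inj] at h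
    obtain ⟨rfl, rfl⟩ := ih (by simpa using hlen) hl.1 hl'.1 h
    exact ⟨rfl, rfl⟩

theorem exists_leftForm {d : ℤ} (hc : 0 < c) (hd : 0 < d) (he : e = d ∨ e = -d)
    {α : BSGroup c e} (hα : α ∈ bsΛ c e) :
    ∃ (l : List ℤ) (p : ℤ), (∀ m ∈ l, 0 ≤ m ∧ m < d) ∧ α = leftForm c e l p ∧
      (e = d ∨ l = [] → 0 ≤ p) := by
  induction hα using Submonoid.closure_induction_right with
  | one => exact ⟨[], 0, by simp⟩
  | mul_right x _ y hy ih =>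
    obtain ⟨l, p, hl, rfl, hp⟩ := ih
    obtain rfl | rfl := hy
    · have hbound : 0 ≤ p % d ∧ p % d < d := ⟨Int.emod_nonneg _ hd.ne', Int.emod_lt_of_pos _ hd⟩
      have hl' : ∀ m ∈ l ++ [p % d], 0 ≤ m ∧ m < d := by
        rw [List.forall_mem_append, List.forall_mem_singleton]
        exact ⟨hl, hbound⟩
      obtain ⟨n, hn, hnonneg⟩ : ∃ n, p = p % d + e * n ∧ (e = d → 0 ≤ p → 0 ≤ n) := by
        obtain rfl | rfl := he
        · exact ⟨p / e, (Int.emod_add_mul_ediv p e).symm, fun _ h => Int.ediv_nonneg h hd.le⟩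
        · exact ⟨-(p / d), by rw [neg_mul_neg, Int.emod_add_mul_ediv], by omega⟩
      refine ⟨l ++ [p % d], c * n, hl', ?_, ?_⟩
      · rw [leftForm_append_singleton, mul_assoc, bsa_mul_bsb_zpow_mul]
        nth_rw 1 [hn]
        simp [leftForm, zpow_add, mul_assoc]
      · simp only [List.append_eq_nil_iff, List.cons_ne_self, and_false, or_false]
        exact fun h => mul_nonneg hc.le (hnonneg h (hp (.inl h)))
    · exact ⟨l, p + 1, hl, by simp [leftForm, zpow_add, mul_assoc], fun h => by linarith [hp h]⟩

theorem exists_rightForm {d : ℤ} (hc : 0 < c) (hd : 0 < d)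
    {α : BSGroup c e} (hα : α ∈ bsΛ c e) :
    ∃ (q : ℤ) (l : List ℤ), (∀ m ∈ l, 0 ≤ m ∧ m < c) ∧ α = rightForm c e q l ∧
      (e = d → 0 ≤ q) := by
  induction hα using Submonoid.closure_induction_left with
  | one => exact ⟨0, [], by simp⟩
  | mul_left y hy x _ ih =>
    obtain ⟨q, l, hl, rfl, hq⟩ := ih
    obtain rfl | rfl := hy
    · refine ⟨e * (q / c), (q % c) :: l, ?_, ?_, ?_⟩
      · rw [List.forall_mem_cons]
        exact ⟨⟨Int.emod_nonneg _ hc.ne', Int.emod_lt_of_pos _ hc⟩, hl⟩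
      · rw [rightForm_cons, ← bsa_mul_bsb_zpow_mul]
        nth_rw 1 [← Int.mul_ediv_add_emod q c]
        simp only [rightForm, zpow_add, mul_assoc]
      · rintro rfl
        exact mul_nonneg hd.le (Int.ediv_nonneg (hq rfl) hc.le)
    · exact ⟨1 + q, l, hl, by simp [rightForm, zpow_add, mul_assoc], fun h => by linarith [hq h]⟩

section height

variable (θ : BSGroup c e →* Multiplicative ℤ)

theorem height_leftForm (hθa : θ (bsa c e) = Multiplicative.ofAdd 1) (hθb : θ (bsb c e) = 1)
    (l : List ℤ) (p : ℤ) : (θ (leftForm c e l p)).toAdd = l.length := by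
  induction l with
  | nil => simp [hθb]
  | cons m l ih => simp [leftForm_cons, hθa, hθb, ih, add_comm]

theorem height_rightForm (hθa : θ (bsa c e) = Multiplicative.ofAdd 1) (hθb : θ (bsb c e) = 1)
    (q : ℤ) (l : List ℤ) : (θ (rightForm c e q l)).toAdd = l.length := by
  induction l generalizing q with
  | nil => simp [hθb]
  | cons m l ih => simp [rightForm_cons, hθa, hθb, ih, add_comm]

end height

end BSGroup

/-- Every `α ∈ Λ` has a unique representation in form (L):
`α = b^{i₀} a b^{i₁} a ⋯ b^{i_{k-1}} a b^p` with all `iμ ∈ [0,d)` and `p ∈ ℤ`,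
and a unique representation in form (R):
`α = b^q a b^{j₁} a ⋯ a b^{j_k}` with all `jμ ∈ [0,c)` and `q ∈ ℤ`, where in both
`k = θ(α)` for the height homomorphism `θ` (with `θ(a) = 1`, `θ(b) = 0`).
Moreover in cases (BS1), (BS2) (i.e. `e = d`) one has `p ≥ 0` and `q ≥ 0`, and in
case (BS3) (i.e. `e = -d`), if `θ(α) = 0` then `p = q ≥ 0`. -/
theorem statement1 (c d : ℤ) (hc : 0 < c) (hd : 0 < d) (e : ℤ) (he : e = d ∨ e = -d)
    (θ : BSGroup c e → ℤ) (hθ : ∀ x y, θ (x * y) = θ x + θ y)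
    (hθa : θ (bsa c e) = 1) (hθb : θ (bsb c e) = 0)
    (α : BSGroup c e) (hα : α ∈ bsΛ c e) :
    (∃! w : List ℤ × ℤ,
      ((w.1.length : ℤ) = θ α ∧ (∀ m ∈ w.1, 0 ≤ m ∧ m < d)) ∧
      α = (w.1.map (fun m => bsb c e ^ m * bsa c e)).prod * bsb c e ^ w.2) ∧
    (∃! w : ℤ × List ℤ,
      ((w.2.length : ℤ) = θ α ∧ (∀ m ∈ w.2, 0 ≤ m ∧ m < c)) ∧
      α = bsb c e ^ w.1 * (w.2.map (fun m => bsa c e * bsb c e ^ m)).prod) ∧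
    (∀ w : List ℤ × ℤ,
      (((w.1.length : ℤ) = θ α ∧ (∀ m ∈ w.1, 0 ≤ m ∧ m < d)) ∧
        α = (w.1.map (fun m => bsb c e ^ m * bsa c e)).prod * bsb c e ^ w.2) →
      ∀ w' : ℤ × List ℤ,
      (((w'.2.length : ℤ) = θ α ∧ (∀ m ∈ w'.2, 0 ≤ m ∧ m < c)) ∧
        α = bsb c e ^ w'.1 * (w'.2.map (fun m => bsa c e * bsb c e ^ m)).prod) →
      (e = d → 0 ≤ w.2 ∧ 0 ≤ w'.1) ∧
      (e = -d → θ α = 0 → w.2 = w'.1 ∧ 0 ≤ w.2)) := by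
  have hc0 : c ≠ 0 := hc.ne'
  have he0 : e ≠ 0 := by omega
  have hde : d ∣ e := by rcases he with rfl | rfl <;> simp
  let Θ : BSGroup c e →* Multiplicative ℤ :=
    MonoidHom.mk' (fun x => Multiplicative.ofAdd (θ x)) fun x y => by rw [hθ, ofAdd_add]
  have hΘa : Θ (bsa c e) = Multiplicative.ofAdd 1 := congrArg Multiplicative.ofAdd hθa
  have hΘb : Θ (bsb c e) = 1 := congrArg Multiplicative.ofAdd hθb
  obtain ⟨l, p, hl, hα_left, hp⟩ := BSGroup.exists_leftForm hc hd he hα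
  obtain ⟨q, r, hr, hα_right, hq⟩ := BSGroup.exists_rightForm hc hd hα
  have hl_len : (l.length : ℤ) = θ α := by
    rw [hα_left]; exact (BSGroup.height_leftForm Θ hΘa hΘb l p).symm
  have hr_len : (r.length : ℤ) = θ α := by
    rw [hα_right]; exact (BSGroup.height_rightForm Θ hΘa hΘb q r).symm
  have left_unique (w : List ℤ × ℤ)
      (hw : ((w.1.length : ℤ) = θ α ∧ (∀ m ∈ w.1, 0 ≤ m ∧ m < d)) ∧
        α = BSGroup.leftForm c e w.1 w.2) : w = (l, p) :=
    Prod.ext_iff.mpr <| BSGroup.leftForm_unique hc0 he0 hde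
      (by exact_mod_cast hw.1.1.trans hl_len.symm) hw.1.2 hl (hw.2.symm.trans hα_left)
  have right_unique (w : ℤ × List ℤ)
      (hw : ((w.2.length : ℤ) = θ α ∧ (∀ m ∈ w.2, 0 ≤ m ∧ m < c)) ∧
        α = BSGroup.rightForm c e w.1 w.2) : w = (q, r) :=
    Prod.ext_iff.mpr <| BSGroup.rightForm_unique hc0 he0 (by exact_mod_cast hw.1.1.trans hr_len.symm)
      hw.1.2 hr (hw.2.symm.trans hα_right)
  refine ⟨⟨(l, p), ⟨⟨hl_len, hl⟩, hα_left⟩, left_unique⟩,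
    ⟨(q, r), ⟨⟨hr_len, hr⟩, hα_right⟩, right_unique⟩, fun w hw w' hw' => ?_⟩
  obtain rfl := left_unique w hw
  obtain rfl := right_unique w' hw'
  refine ⟨fun h => ⟨hp (.inl h), hq h⟩, fun _ h => ?_⟩
  obtain rfl : l = [] := List.length_eq_zero_iff.mp (by omega)
  obtain rfl : r = [] := List.length_eq_zero_iff.mp (by omega)
  exact ⟨BSGroup.bsb_zpow_injective hc0 he0 (by simpa using hα_left.symm.trans hα_right),
    hp (.inr rfl)⟩
end

section
/- The monoid Λ has no nontrivial inverses: if α, β ∈ Λ and αβ = e (the identity of Γ), then α = β = e. Consequently (since Γ is a group, so Λ is left- and right-cancellative) Λ is a category of paths. -/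
/-- The height homomorphism `Γ → ℤ`, counting occurrences of `a` with sign. -/
def bsHeight (c e : ℤ) : BSGroup c e →* Multiplicative ℤ :=
  PresentedGroup.toGroup (f := fun g => match g with
    | .a => Multiplicative.ofAdd 1
    | .b => 1) <| by
    rintro r rfl
    simp

/-- Affine permutations of `ℚ` assigned to the generators: `x ↦ q x` and `x ↦ x + 1`. -/
def bsAffineGen (q : ℚ) (hq : q ≠ 0) : BSGen → Equiv.Perm ℚ
  | .a => Equiv.mulLeft₀ q hq
  | .b => Equiv.addRight 1

theorem bsAffineGen_rel {c e : ℤ} (hc : (c : ℚ) ≠ 0) (hq : (e / c : ℚ) ≠ 0)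
    (r : FreeGroup BSGen) (hr : r ∈ BSRel c e) :
    FreeGroup.lift (bsAffineGen (e / c) hq) r = 1 := by
  rw [BSRel, Set.mem_singleton_iff] at hr
  subst hr
  simp only [map_mul, map_inv, map_zpow, FreeGroup.lift_apply_of, mul_inv_eq_one, bsAffineGen]
  ext x
  simp only [Equiv.zsmul_addRight, zsmul_one, Equiv.coe_addRight, Equiv.Perm.mul_apply,
    Equiv.mulLeft₀_apply]
  field_simp

/-- The affine action of `Γ` on `ℚ`: `a` acts by `x ↦ (e / c) x` and `b` by `x ↦ x + 1`. -/
def bsAffine (c e : ℤ) (hc : (c : ℚ) ≠ 0) (hq : (e / c : ℚ) ≠ 0) :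
    BSGroup c e →* Equiv.Perm ℚ :=
  PresentedGroup.toGroup (bsAffineGen_rel hc hq)

theorem bsHeight_bsa (c e : ℤ) : bsHeight c e (bsa c e) = Multiplicative.ofAdd 1 :=
  PresentedGroup.toGroup.of _

theorem bsHeight_bsb (c e : ℤ) : bsHeight c e (bsb c e) = 1 :=
  PresentedGroup.toGroup.of _

theorem bsAffine_bsb (c e : ℤ) (hc : (c : ℚ) ≠ 0) (hq : (e / c : ℚ) ≠ 0) :
    bsAffine c e hc hq (bsb c e) = Equiv.addRight 1 :=
  PresentedGroup.toGroup.of _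

/-- In `Γ` the generator `b` has infinite order. -/
theorem bsb_pow_eq_one_iff {c e : ℤ} (hc : c ≠ 0) (he : e ≠ 0) {n : ℕ} :
    bsb c e ^ n = 1 ↔ n = 0 := by
  refine ⟨fun h => ?_, fun h => by simp [h]⟩
  have hc' : (c : ℚ) ≠ 0 := Int.cast_ne_zero.mpr hc
  have hq : (e / c : ℚ) ≠ 0 := div_ne_zero (Int.cast_ne_zero.mpr he) hc'
  have h' := congrArg (fun g => bsAffine c e hc' hq g 0) h
  simpa [bsAffine_bsb] using h'

/-- Elements of `Λ` have nonnegative height, and those of height zero are powers of `b`. -/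
theorem bsHeight_of_mem_bsΛ {c e : ℤ} {x : BSGroup c e} (hx : x ∈ bsΛ c e) :
    0 ≤ (bsHeight c e x).toAdd ∧
      ((bsHeight c e x).toAdd = 0 → ∃ n : ℕ, x = bsb c e ^ n) := by
  induction hx using Submonoid.closure_induction with
  | mem x hx =>
    rcases hx with rfl | rfl
    · simp [bsHeight_bsa]
    · simpa [bsHeight_bsb] using ⟨1, (pow_one _).symm⟩
  | one => simpa using ⟨0, (pow_zero _).symm⟩
  | mul x y _ _ hx hy =>
    rw [map_mul, toAdd_mul]
    refine ⟨add_nonneg hx.1 hy.1, fun h => ?_⟩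
    obtain ⟨m, rfl⟩ := hx.2 (by linarith [hx.1, hy.1])
    obtain ⟨n, rfl⟩ := hy.2 (by linarith [hx.1, hy.1])
    exact ⟨m + n, (pow_add _ _ _).symm⟩

/-- The monoid `Λ` has no nontrivial inverses: if `α, β ∈ Λ` and `αβ = e` then
`α = β = e`.  (Consequently, since `Γ` is a group and hence `Λ` is left- and
right-cancellative, `Λ` is a category of paths.) -/
theorem statement2 (c d : ℤ) (hc : 0 < c) (hd : 0 < d) (e : ℤ) (he : e = d ∨ e = -d)
    (α β : BSGroup c e) (hα : α ∈ bsΛ c e) (hβ : β ∈ bsΛ c e)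
    (h : α * β = 1) : α = 1 ∧ β = 1 := by
  have hc' : c ≠ 0 := hc.ne'
  have he' : e ≠ 0 := by omega
  have hα' := bsHeight_of_mem_bsΛ hα
  have hβ' := bsHeight_of_mem_bsΛ hβ
  have hsum : (bsHeight c e α).toAdd + (bsHeight c e β).toAdd = 0 := by
    rw [← toAdd_mul, ← map_mul, h, map_one, toAdd_one]
  obtain ⟨m, rfl⟩ := hα'.2 (by linarith [hα'.1, hβ'.1])
  obtain ⟨n, rfl⟩ := hβ'.2 (by linarith [hα'.1, hβ'.1])
  rw [← pow_add, bsb_pow_eq_one_iff hc' he'] at h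
  rw [bsb_pow_eq_one_iff hc' he', bsb_pow_eq_one_iff hc' he']
  omega
end

section
/- Let α ∈ Λ and let k be a positive integer. If k < θ(α), or if k = θ(α) and we are in case (BS1) or (BS2), then there is a unique element β of the form β = b^{i_0} a b^{i_1} a ⋯ b^{i_{k−1}} a with all i_μ ∈ [0, d) such that α ∈ βΛ. If k = θ(α) > 0 and we are in case (BS3), then there are a unique element α₀ of the form b^{i_0} a ⋯ b^{i_{k−1}} a with all i_μ ∈ [0, d), and a unique p₀ ∈ ℤ, such that the set of initial segments of α of height k is exactly {α₀ b^q : q ∈ ℤ, q ≤ p₀}. -/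
open MulOpposite in
/-- The right action of `Γ` on normal forms, encoded as a homomorphism to the opposite of a
permutation group together with a base point separating the words `b^{i₀} a ⋯ b^{iₖ₋₁} a b^p`. -/
theorem exists_right_action (c d : ℤ) (hc : 0 < c) (hd : 0 < d) (e : ℤ) (he : e = d ∨ e = -d) :
    ∃ ρ : BSGroup c e →* (Equiv.Perm ((List ℤ ⊕ ℕ) × ℤ))ᵐᵒᵖ,
      (∀ y n, (ρ (bsb c e)).unop (y, n) = (y, n + 1)) ∧
      ∀ l r, 0 ≤ r → r < d →
        (ρ (bsa c e)).unop (Sum.inl l, r) = (Sum.inl (l ++ [r]), 0) := by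
  have he0 : e ≠ 0 := by omega
  have hde : |e| = d := by
    rcases he with rfl | rfl
    · exact abs_of_pos hd
    · rw [abs_neg, abs_of_pos hd]
  let Y := List ℤ ⊕ ℕ
  let D := {r : ℤ // 0 ≤ r ∧ r < d}
  let C := {r : ℤ // 0 ≤ r ∧ r < c}
  let s : Set (Y × D) := {x | ∃ l, x.1 = Sum.inl l}
  let f₀ : s → Y × C := fun x =>
    (Sum.inl (x.1.1.elim id (fun _ => []) ++ [x.1.2.1]), ⟨0, le_rfl, hc⟩)
  have hf₀ : Function.Injective f₀ := by
    rintro ⟨⟨y, r⟩, l, rfl : y = _⟩ ⟨⟨y', r'⟩, l', rfl : y' = _⟩ h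
    simp only [f₀, Prod.mk.injEq, Sum.elim_inl, id, and_true] at h
    obtain ⟨h₁, h₂⟩ := List.append_inj' (Sum.inl.inj h) rfl
    have h₃ : r = r' := Subtype.ext (by simpa using h₂)
    subst h₁ h₃
    rfl
  have hs : Infinite (sᶜ : Set (Y × D)) := by
    refine Infinite.of_injective
      (fun n : ℕ => ⟨(Sum.inr n, ⟨0, le_rfl, hd⟩), by rintro ⟨l, hl⟩; cases hl⟩) ?_
    intro m n h
    exact Sum.inr.inj (congrArg (fun x => x.1.1) h)
  have ht : Infinite ((Set.range (⟨f₀, hf₀⟩ : s ↪ Y × C))ᶜ : Set (Y × C)) := by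
    refine Infinite.of_injective
      (fun n : ℕ => ⟨(Sum.inr n, ⟨0, le_rfl, hc⟩), by rintro ⟨x, hx⟩; cases hx⟩) ?_
    intro m n h
    exact Sum.inr.inj (congrArg (fun x => x.1.1) h)
  obtain ⟨ψ, hψ⟩ := Cardinal.extend_function ⟨f₀, hf₀⟩ (nonempty_equiv_of_countable)
  have hdig : ∀ n : ℤ, 0 ≤ n % e ∧ n % e < d := fun n =>
    ⟨Int.emod_nonneg n he0, hde ▸ Int.emod_lt_abs n he0⟩
  let split (m : ℤ) (t : ℤ) (hm : ∀ n : ℤ, 0 ≤ n % m ∧ n % m < t) (hm0 : m ≠ 0) (ht : |m| = t) :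
      Y × ℤ ≃ (Y × {r : ℤ // 0 ≤ r ∧ r < t}) × ℤ :=
    { toFun := fun x => ((x.1, ⟨x.2 % m, hm x.2⟩), x.2 / m)
      invFun := fun x => (x.1.1, x.1.2.1 + m * x.2)
      left_inv := fun x => Prod.ext rfl (Int.emod_add_mul_ediv x.2 m)
      right_inv := by
        rintro ⟨⟨y, r, hr0, hr⟩, q⟩
        have h1 : (r + m * q) % m = r := by
          rw [Int.add_mul_emod_self_left, ← Int.emod_abs, ht, Int.emod_eq_of_lt hr0 hr]
        have h2 : (r + m * q) / m = q := by
          have := Int.emod_add_mul_ediv (r + m * q) m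
          rw [h1] at this
          exact mul_left_cancel₀ hm0 (add_left_cancel this)
        simp [h1, h2] }
  let A : Equiv.Perm (Y × ℤ) :=
    ((split e d hdig he0 hde).trans (ψ.prodCongr (Equiv.refl ℤ))).trans
      (split c c (fun n => ⟨Int.emod_nonneg n hc.ne', Int.emod_lt_of_pos n hc⟩) hc.ne'
        (abs_of_pos hc)).symm
  let B : Equiv.Perm (Y × ℤ) := (Equiv.refl Y).prodCongr (Equiv.addRight 1)
  have hA : ∀ y n, A (y, n) = ((ψ (y, ⟨n % e, hdig n⟩)).1,
      (ψ (y, ⟨n % e, hdig n⟩)).2.1 + c * (n / e)) := fun y n => rfl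
  have hB : ∀ y n, B (y, n) = (y, n + 1) := fun y n => rfl
  have hBn : ∀ (k : ℕ) y n, (B ^ k) (y, n) = (y, n + k) := by
    intro k
    induction k with
    | zero => simp
    | succ k ih => intro y n; rw [pow_succ, Equiv.Perm.mul_apply, hB, ih]; push_cast; congr 1; ring
  have hBz : ∀ (k : ℤ) y n, (B ^ k) (y, n) = (y, n + k) := by
    intro k y n
    obtain ⟨k, rfl | rfl⟩ := k.eq_nat_or_neg
    · rw [zpow_natCast, hBn]
    · rw [zpow_neg, zpow_natCast, Equiv.Perm.inv_eq_iff_eq, hBn]; simp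
  have hrel : B ^ c * A = A * B ^ e := by
    ext1 ⟨y, n⟩
    rw [Equiv.Perm.mul_apply, Equiv.Perm.mul_apply, hBz, hA, hA, hBz]
    have h : (n + e) / e = n / e + 1 := by simpa using Int.add_mul_ediv_right n 1 he0
    simp only [Int.add_emod_right, h]
    congr 1
    ring
  let g : BSGen → (Equiv.Perm (Y × ℤ))ᵐᵒᵖ := fun x => BSGen.casesOn x (op A) (op B)
  have hg : ∀ r ∈ BSRel c e, FreeGroup.lift g r = 1 := by
    rintro r rfl
    rw [map_mul, map_inv, mul_inv_eq_one]
    simp only [map_mul, map_zpow, FreeGroup.lift_apply_of, g]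
    rw [← op_zpow, ← op_zpow, ← op_mul, ← op_mul, hrel]
  refine ⟨PresentedGroup.toGroup hg, ?_, ?_⟩
  · intro y n
    rw [bsb, PresentedGroup.toGroup.of]
    rfl
  · intro l r hr0 hr
    rw [bsa, PresentedGroup.toGroup.of]
    change A (Sum.inl l, r) = _
    have h1 : r % e = r := by rw [← Int.emod_abs, hde, Int.emod_eq_of_lt hr0 hr]
    have h2 : r / e = 0 := by
      have := Int.emod_add_mul_ediv r e
      rw [h1] at this
      exact (mul_eq_zero.1 (by linarith)).resolve_left he0
    have h3 := hψ ⟨(Sum.inl l, ⟨r, hr0, hr⟩), l, rfl⟩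
    rw [hA]
    simp only [h1, h2]
    simp only [h3, f₀, Function.Embedding.coeFn_mk]
    simp

/-- The word `b^{i₀} a ⋯ b^{iₖ₋₁} a` with exponents read off from a list. -/
def bsWord (c e : ℤ) (i : List ℤ) : BSGroup c e :=
  (i.map (fun m => bsb c e ^ m * bsa c e)).prod

theorem bsWord_append (c e : ℤ) (i j : List ℤ) :
    bsWord c e (i ++ j) = bsWord c e i * bsWord c e j := by
  simp [bsWord]

theorem bsWord_singleton (c e m : ℤ) : bsWord c e [m] = bsb c e ^ m * bsa c e := by
  simp [bsWord]

/-- Uniqueness of normal forms for elements of `Λ`. -/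
theorem bsWord_mul_zpow_inj {c d : ℤ} (hc : 0 < c) (hd : 0 < d) {e : ℤ} (he : e = d ∨ e = -d)
    {i j : List ℤ} (hi : ∀ m ∈ i, 0 ≤ m ∧ m < d) (hj : ∀ m ∈ j, 0 ≤ m ∧ m < d) {p q : ℤ}
    (h : bsWord c e i * bsb c e ^ p = bsWord c e j * bsb c e ^ q) : i = j ∧ p = q := by
  obtain ⟨ρ, hb, ha⟩ := exists_right_action c d hc hd e he
  have hbn : ∀ (k : ℕ) y n, (ρ (bsb c e ^ k)).unop (y, n) = (y, n + k) := by
    intro k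
    induction k with
    | zero => simp
    | succ k ih =>
      intro y n
      rw [pow_succ, map_mul, MulOpposite.unop_mul, Equiv.Perm.mul_apply, ih, hb]
      push_cast
      rw [add_assoc]
  have hbz : ∀ (k : ℤ) y n, (ρ (bsb c e ^ k)).unop (y, n) = (y, n + k) := by
    intro k y n
    obtain ⟨k, rfl | rfl⟩ := k.eq_nat_or_neg
    · rw [zpow_natCast, hbn]
    · rw [zpow_neg, zpow_natCast, map_inv, MulOpposite.unop_inv, Equiv.Perm.inv_eq_iff_eq, hbn]
      simp
  have hw : ∀ i : List ℤ, (∀ m ∈ i, 0 ≤ m ∧ m < d) →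
      (ρ (bsWord c e i)).unop (Sum.inl [], 0) = (Sum.inl i, 0) := by
    intro i
    induction i using List.reverseRecOn with
    | nil => simp [bsWord]
    | append_singleton l m ih =>
      intro h
      have hm := h m (by simp)
      rw [bsWord_append, bsWord_singleton, map_mul, map_mul, MulOpposite.unop_mul,
        MulOpposite.unop_mul, Equiv.Perm.mul_apply, Equiv.Perm.mul_apply,
        ih fun m' hm' => h m' (by simp [hm']), hbz, zero_add, ha l m hm.1 hm.2]
  have key := congrArg (fun x => (ρ x).unop (Sum.inl [], 0)) h
  simpa [hw i hi, hw j hj, hbz, -map_zpow] using key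

theorem bsa_mul_bsb_zpow (c e q : ℤ) :
    bsa c e * bsb c e ^ (c * q) = bsb c e ^ (e * q) * bsa c e := by
  have h : bsa c e * bsb c e ^ c = bsb c e ^ e * bsa c e := by
    have h1 := PresentedGroup.one_of_mem (rels := BSRel c e) rfl
    rw [map_mul, map_inv, mul_inv_eq_one] at h1
    simpa [bsa, bsb, PresentedGroup.of] using h1
  rw [zpow_mul, zpow_mul]
  exact SemiconjBy.zpow_right h q

theorem bsa_mem (c e : ℤ) : bsa c e ∈ bsΛ c e := Submonoid.subset_closure (by simp)

theorem bsb_zpow_mem (c e : ℤ) {p : ℤ} (hp : 0 ≤ p) : bsb c e ^ p ∈ bsΛ c e := by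
  lift p to ℕ using hp
  rw [zpow_natCast]
  exact pow_mem (Submonoid.subset_closure (by simp)) p

theorem bsWord_mem (c e : ℤ) {i : List ℤ} (hi : ∀ m ∈ i, 0 ≤ m) : bsWord c e i ∈ bsΛ c e := by
  refine Submonoid.list_prod_mem _ fun x hx => ?_
  obtain ⟨m, hm, rfl⟩ := List.mem_map.1 hx
  exact mul_mem (bsb_zpow_mem c e (hi m hm)) (bsa_mem c e)

theorem bsWord_mul_zpow_mem {c d : ℤ} (hc : 0 < c) (hd : 0 < d) {e : ℤ} (he : e = d ∨ e = -d)
    {i : List ℤ} (hi : ∀ m ∈ i, 0 ≤ m) {p : ℤ} (hp : e = d → 0 ≤ p) (hp' : i = [] → 0 ≤ p) :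
    bsWord c e i * bsb c e ^ p ∈ bsΛ c e := by
  by_cases h0 : 0 ≤ p
  · exact mul_mem (bsWord_mem c e hi) (bsb_zpow_mem c e h0)
  obtain rfl : e = -d := he.resolve_left fun h => h0 (hp h)
  induction i using List.reverseRecOn with
  | nil => exact absurd (hp' rfl) h0
  | append_singleton l m _ =>
    have hpc : 0 ≤ p - c * p := by nlinarith
    have hdp : 0 ≤ -d * p := by nlinarith
    have key : bsa c (-d) * bsb c (-d) ^ p =
        bsb c (-d) ^ (-d * p) * bsa c (-d) * bsb c (-d) ^ (p - c * p) := by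
      rw [← bsa_mul_bsb_zpow, mul_assoc, ← zpow_add, add_sub_cancel]
    rw [bsWord_append, bsWord_singleton, mul_assoc, mul_assoc, key]
    exact mul_mem (bsWord_mem _ _ fun m' h => hi m' (by simp [h]))
      (mul_mem (bsb_zpow_mem _ _ (hi m (by simp)))
        (mul_mem (mul_mem (bsb_zpow_mem _ _ hdp) (bsa_mem _ _)) (bsb_zpow_mem _ _ hpc)))

/-- Existence of normal forms for elements of `Λ`. -/
theorem exists_bsWord_mul_zpow {c d : ℤ} (hc : 0 < c) (hd : 0 < d) {e : ℤ} (he : e = d ∨ e = -d)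
    {α : BSGroup c e} (hα : α ∈ bsΛ c e) :
    ∃ (i : List ℤ) (p : ℤ), (∀ m ∈ i, 0 ≤ m ∧ m < d) ∧ (e = d → 0 ≤ p) ∧ (i = [] → 0 ≤ p) ∧
      α = bsWord c e i * bsb c e ^ p := by
  have he0 : e ≠ 0 := by omega
  have hde : |e| = d := by
    rcases he with rfl | rfl
    · exact abs_of_pos hd
    · rw [abs_neg, abs_of_pos hd]
  induction hα using Submonoid.closure_induction_right with
  | one => exact ⟨[], 0, by simp [bsWord]⟩
  | mul_right x _ y hy ih =>
    obtain ⟨i, p, hi, hp, hp', rfl⟩ := ih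
    rcases hy with rfl | rfl
    · refine ⟨i ++ [p % e], c * (p / e), ?_, ?_, by simp, ?_⟩
      · intro m hm
        rcases List.mem_append.1 hm with hm | hm
        · exact hi m hm
        · rw [List.mem_singleton.1 hm]
          exact ⟨Int.emod_nonneg p he0, hde ▸ Int.emod_lt_abs p he0⟩
      · rintro rfl
        exact mul_nonneg hc.le (Int.ediv_nonneg (hp rfl) hd.le)
      · rw [bsWord_append, bsWord_singleton, mul_assoc, mul_assoc, mul_assoc, bsa_mul_bsb_zpow,
          ← mul_assoc (bsb c e ^ (p % e)), ← zpow_add, Int.emod_add_mul_ediv]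
    · exact ⟨i, p + 1, hi, fun h => by linarith [hp h], fun h => by linarith [hp' h],
        by rw [zpow_add_one, mul_assoc]⟩

theorem height_bsWord_mul_zpow {c e : ℤ} (θ : BSGroup c e → ℤ)
    (hθ : ∀ x y, θ (x * y) = θ x + θ y) (hθa : θ (bsa c e) = 1) (hθb : θ (bsb c e) = 0)
    (i : List ℤ) (p : ℤ) : θ (bsWord c e i * bsb c e ^ p) = i.length := by
  have h1 : θ 1 = 0 := by simpa using hθ 1 1
  have hb : ∀ p : ℤ, θ (bsb c e ^ p) = 0 := by
    intro p
    induction p using Int.induction_on with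
    | zero => simpa using h1
    | succ n ih => rw [zpow_add_one, hθ, ih, hθb, add_zero]
    | pred n ih =>
      have := hθ (bsb c e ^ (-(n : ℤ) - 1)) (bsb c e)
      rw [← zpow_add_one, sub_add_cancel, ih, hθb] at this
      linarith
  rw [hθ, hb, add_zero]
  induction i with
  | nil => simpa [bsWord] using h1
  | cons m l ih =>
    rw [← List.singleton_append, bsWord_append, bsWord_singleton, hθ, hθ, hb, ih, hθa]
    simp
    ring

/-- Unique initial segments of a given positive height `k`.  If `k < θ(α)`, or `k = θ(α)`
in cases (BS1)/(BS2) (`e = d`), there is a unique `β = b^{i₀} a ⋯ b^{i_{k-1}} a` with all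
`iμ ∈ [0,d)` such that `α ∈ βΛ`.  If `k = θ(α) > 0` in case (BS3) (`e = -d`), there are a
unique `α₀` of that form and a unique `p₀ ∈ ℤ` such that the initial segments of `α` of
height `k` are exactly `{α₀ b^q : q ≤ p₀}`. -/
theorem statement3 (c d : ℤ) (hc : 0 < c) (hd : 0 < d) (e : ℤ) (he : e = d ∨ e = -d)
    (θ : BSGroup c e → ℤ) (hθ : ∀ x y, θ (x * y) = θ x + θ y)
    (hθa : θ (bsa c e) = 1) (hθb : θ (bsb c e) = 0)
    (α : BSGroup c e) (hα : α ∈ bsΛ c e) (k : ℕ) (hk : 0 < k) :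
    (((k : ℤ) < θ α ∨ ((k : ℤ) = θ α ∧ e = d)) →
      ∃! β : BSGroup c e,
        (∃ i : List ℤ, i.length = k ∧ (∀ m ∈ i, 0 ≤ m ∧ m < d) ∧
          β = (i.map (fun m => bsb c e ^ m * bsa c e)).prod) ∧
        ∃ γ ∈ bsΛ c e, α = β * γ) ∧
    ((e = -d ∧ (k : ℤ) = θ α) →
      ∃! w : BSGroup c e × ℤ,
        (∃ i : List ℤ, i.length = k ∧ (∀ m ∈ i, 0 ≤ m ∧ m < d) ∧
          w.1 = (i.map (fun m => bsb c e ^ m * bsa c e)).prod) ∧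
        ∀ β : BSGroup c e,
          (β ∈ bsΛ c e ∧ θ β = (k : ℤ) ∧ ∃ γ ∈ bsΛ c e, α = β * γ) ↔
          (∃ q : ℤ, q ≤ w.2 ∧ β = w.1 * bsb c e ^ q)) := by
  obtain ⟨i, p, hi, hp, hp', rfl⟩ := exists_bsWord_mul_zpow hc hd he hα
  have hht := height_bsWord_mul_zpow θ hθ hθa hθb
  have hmem : ∀ {l : List ℤ}, (∀ m ∈ l, 0 ≤ m ∧ m < d) → ∀ m ∈ l, 0 ≤ m :=
    fun h m hm => (h m hm).1
  rw [hht]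
  constructor
  · intro hk'
    have htake : ∀ m ∈ i.take k, 0 ≤ m ∧ m < d := fun m hm => hi m (List.mem_of_mem_take hm)
    have hdrop : ∀ m ∈ i.drop k, 0 ≤ m ∧ m < d := fun m hm => hi m (List.mem_of_mem_drop hm)
    refine ⟨bsWord c e (i.take k), ⟨⟨i.take k, ?_, htake, rfl⟩,
      bsWord c e (i.drop k) * bsb c e ^ p, ?_, ?_⟩, ?_⟩
    · rw [List.length_take]
      omega
    · refine bsWord_mul_zpow_mem hc hd he (hmem hdrop) hp fun h => ?_
      have := List.drop_eq_nil_iff.1 h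
      exact hp (by omega)
    · rw [← mul_assoc, ← bsWord_append, List.take_append_drop]
    · rintro _ ⟨⟨j, hjk, hj, rfl⟩, γ, hγ, h⟩
      obtain ⟨l, q, hl, -, -, rfl⟩ := exists_bsWord_mul_zpow hc hd he hγ
      change _ = bsWord c e j * _ at h
      rw [← mul_assoc, ← bsWord_append] at h
      have hjl : ∀ m ∈ j ++ l, 0 ≤ m ∧ m < d := fun m hm =>
        (List.mem_append.1 hm).elim (hj m) (hl m)
      obtain ⟨rfl, -⟩ := bsWord_mul_zpow_inj hc hd he hi hjl h
      rw [List.take_left' hjk]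
      rfl
  · rintro ⟨rfl, hk'⟩
    have hne : ∀ {l : List ℤ}, l.length = k → l ≠ [] := by
      rintro l hl rfl
      simp at hl
      omega
    have hik : i.length = k := by exact_mod_cast hk'.symm
    have hinj := @bsWord_mul_zpow_inj c d hc hd (-d) he
    refine ⟨(bsWord c (-d) i, p), ⟨⟨i, hik, hi, rfl⟩, ?_⟩, ?_⟩
    · intro β
      constructor
      · rintro ⟨hβ, hβk, γ, hγ, h⟩
        obtain ⟨j, q, hj, -, -, rfl⟩ := exists_bsWord_mul_zpow hc hd he hβ
        obtain ⟨l, s, hl, -, hs, rfl⟩ := exists_bsWord_mul_zpow hc hd he hγ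
        have hlen := congrArg θ h
        rw [hht, hθ, hht, hht] at hlen
        rw [hht] at hβk
        obtain rfl : l = [] := List.length_eq_zero_iff.1 (by omega)
        have h' : bsWord c (-d) i * bsb c (-d) ^ p =
            bsWord c (-d) j * bsb c (-d) ^ (q + s) := by
          rw [h, zpow_add]
          simp [bsWord, mul_assoc]
        obtain ⟨rfl, rfl⟩ := hinj hi hj h'
        exact ⟨q, by simpa using hs rfl, rfl⟩
      · rintro ⟨q, hq, rfl⟩
        refine ⟨bsWord_mul_zpow_mem hc hd he (hmem hi) (by omega) fun h => absurd h (hne hik),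
          ?_, bsb c (-d) ^ (p - q), bsb_zpow_mem _ _ (sub_nonneg.2 hq), ?_⟩
        · rw [hht, hik]
        · rw [mul_assoc, ← zpow_add, add_sub_cancel]
    · rintro ⟨_, q⟩ ⟨⟨j, hjk, hj, rfl⟩, h⟩
      change ∀ β, _ ↔ ∃ q' : ℤ, q' ≤ q ∧ β = bsWord c (-d) j * bsb c (-d) ^ q' at h
      change (bsWord c (-d) j, q) = _
      obtain ⟨r, hr, h₁⟩ := (h (bsWord c (-d) i * bsb c (-d) ^ p)).1
        ⟨hα, by rw [hht, hik], 1, one_mem _, (mul_one _).symm⟩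
      obtain ⟨rfl, rfl⟩ := hinj hi hj h₁
      obtain ⟨-, -, γ, hγ, h₂⟩ := (h (bsWord c (-d) i * bsb c (-d) ^ q)).2 ⟨q, le_rfl, rfl⟩
      obtain ⟨l, s, hl, -, hs, rfl⟩ := exists_bsWord_mul_zpow hc hd he hγ
      have hlen := congrArg θ h₂
      rw [hht, hθ, hht, hht] at hlen
      obtain rfl : l = [] := List.length_eq_zero_iff.1 (by omega)
      have h' : bsWord c (-d) i * bsb c (-d) ^ p =
          bsWord c (-d) i * bsb c (-d) ^ (q + s) := by
        rw [h₂, zpow_add]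
        simp [bsWord, mul_assoc]
      have h₃ := (hinj hi hi h').2
      have h₄ := hs rfl
      rw [show q = p by omega]
end
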